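/- arXiv:1205.3016 — 8 statements merged into one kernel-verified Lean document; each statement's English description precedes it below -/
import Mathlib

section
/- (Key Lemma) Let (A, α) and (B, β) be C*-dynamical systems, γ : A → B a *-isomorphism, and b₁ ∈ B an invertible element satisfying β(γ(a)) b₁ = b₁ γ(α(a)) for all a ∈ A. Then there exists a unitary w ∈ B such that β(b) = w (γ(α(γ⁻¹(b)))) w* for all b ∈ B; namely w may be taken to be the unitary part b₁ (b₁* b₁)^{-1/2} of the polar decomposition of b₁. -/
/-- An element commuting with `a` commutes with `Ring.inverse a`. -/
theorem Commute.ringInverse_left {M₀ : Type*} [MonoidWithZero M₀] {a b : M₀} (h : Commute a b) :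
    Commute (Ring.inverse a) b := by
  by_cases ha : IsUnit a
  · obtain ⟨u, rfl⟩ := ha
    rw [Ring.inverse_unit]
    exact h.units_inv_left
  · rw [Ring.inverse_non_unit _ ha]
    exact Commute.zero_left b

/-- The unitary part `b (b* b)^{-1/2}` of the polar decomposition of an invertible element of a
C*-algebra is unitary. -/
theorem IsUnit.mul_inverse_sqrt_star_mul_self_mem_unitary {B : Type*} [CStarAlgebra B]
    [PartialOrder B] [StarOrderedRing B] {b : B} (hb : IsUnit b) :
    b * Ring.inverse (CFC.sqrt (star b * b)) ∈ unitary B := by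
  have hs : CFC.sqrt (star b * b) * CFC.sqrt (star b * b) = star b * b :=
    CFC.sqrt_mul_sqrt_self _ (star_mul_self_nonneg b)
  have hsu : IsUnit (CFC.sqrt (star b * b)) := by
    rw [← isUnit_pow_iff two_ne_zero, pow_two, hs]
    exact hb.star.mul hb
  have hsa : star (CFC.sqrt (star b * b)) = CFC.sqrt (star b * b) :=
    (CFC.sqrt_nonneg _).isSelfAdjoint
  generalize CFC.sqrt (star b * b) = s at *
  obtain ⟨u, rfl⟩ := hsu
  rw [Ring.inverse_unit]
  have hu : star (↑u⁻¹ : B) = ↑u⁻¹ := by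
    have hus : star u = u := Units.ext hsa
    rw [← Units.coe_star_inv, hus]
  have hw : star (b * ↑u⁻¹) * (b * ↑u⁻¹) = 1 := by
    calc star (b * ↑u⁻¹) * (b * ↑u⁻¹) = ↑u⁻¹ * (star b * b) * ↑u⁻¹ := by
          rw [star_mul, hu]; simp only [mul_assoc]
      _ = 1 := by rw [← hs]; simp
  refine Unitary.mem_iff.mpr ⟨hw, (hb.mul u⁻¹.isUnit).mul_left_injective ?_⟩
  simp only [mul_assoc (b * (↑u⁻¹ : B)), hw, mul_one, one_mul]

/-- If `b` intertwines `x` with `y` and `star x` with `star y`, then `b (b* b)^{-1/2}` intertwines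
`x` with `y`. -/
theorem SemiconjBy.mul_inverse_sqrt_star_mul_self {B : Type*} [CStarAlgebra B]
    [PartialOrder B] [StarOrderedRing B] {b x y : B} (h : SemiconjBy b x y)
    (h' : SemiconjBy b (star x) (star y)) :
    SemiconjBy (b * Ring.inverse (CFC.sqrt (star b * b))) x y := by
  have hstar : SemiconjBy (star b) y x := by
    simpa [SemiconjBy] using (congrArg star h'.eq).symm
  have hs : Commute (CFC.sqrt (star b * b)) x := by
    rw [CFC.sqrt_eq_rpow, CFC.rpow_def]
    exact Commute.cfc_nnreal (hstar.mul_left h) _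
  exact h.mul_left hs.ringInverse_left

/-- Key Lemma: if `b₁` is invertible and `β(γ(a)) b₁ = b₁ γ(α(a))` for all `a ∈ A`, then
the unitary part `w = b₁ (b₁* b₁)^{-1/2}` of the polar decomposition of `b₁` is a unitary
element of `B` implementing `β(b) = w γ(α(γ⁻¹(b))) w*`. -/
theorem key_lemma_outer_conjugate
    (A B : Type*) [CStarAlgebra A] [CStarAlgebra B] [PartialOrder B] [StarOrderedRing B]
    (α : A →⋆ₐ[ℂ] A) (β : B →⋆ₐ[ℂ] B) (γ : A ≃⋆ₐ[ℂ] B)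
    (b₁ : B) (hb₁ : IsUnit b₁)
    (h : ∀ a : A, β (γ a) * b₁ = b₁ * γ (α a)) :
    ∃ w : B, w = b₁ * Ring.inverse (CFC.sqrt (star b₁ * b₁)) ∧ w ∈ unitary B ∧
      ∀ b : B, β b = w * (γ (α (γ.symm b))) * star w := by
  have hw := hb₁.mul_inverse_sqrt_star_mul_self_mem_unitary
  refine ⟨_, rfl, hw, fun b ↦ ?_⟩
  have hb (b : B) : SemiconjBy b₁ (γ (α (γ.symm b))) (β b) := by
    simpa [SemiconjBy] using (h (γ.symm b)).symm
  have hb' : SemiconjBy b₁ (star (γ (α (γ.symm b)))) (star (β b)) := by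
    simpa only [map_star] using hb (star b)
  rw [((hb b).mul_inverse_sqrt_star_mul_self hb').eq, mul_assoc, Unitary.mul_star_self_of_mem hw,
    mul_one]
end

section
/- Let (A, α) and (B, β) be C*-dynamical systems with α surjective, let γ : A → B be a *-isomorphism, and let b₁ ∈ B be a right invertible element satisfying β(γ(a)) b₁ = b₁ γ(α(a)) for all a ∈ A. Then b₁ is invertible, and consequently there exists a unitary w ∈ B such that β(b) = w (γ(α(γ⁻¹(b)))) w* for all b ∈ B. -/
/-- If `star c * c` is central in a unital C⋆-algebra, then it has a self-adjoint central square root. -/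
theorem exists_isSelfAdjoint_central_mul_self_eq {B : Type*} [CStarAlgebra B] (c : B)
    (hc : ∀ x : B, Commute (star c * c) x) :
    ∃ d : B, star d = d ∧ d * d = star c * c ∧ ∀ x : B, Commute d x := by
  let _ := CStarAlgebra.spectralOrder B
  have := CStarAlgebra.spectralOrderedRing B
  have hpos : 0 ≤ star c * c := star_mul_self_nonneg c
  refine ⟨CFC.sqrt (star c * c), ?_, CFC.sqrt_mul_sqrt_self _ hpos, fun x ↦ ?_⟩
  · exact (CFC.sqrt_nonneg (star c * c)).isSelfAdjoint
  · exact (hc x).cfcₙ_nnreal NNReal.sqrt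

/-- The surjective case: if `α` is surjective and `b₁` is right invertible with
`β(γ(a)) b₁ = b₁ γ(α(a))` for all `a ∈ A`, then `b₁` is invertible and the systems are
outer conjugate via a unitary `w ∈ B`. -/
theorem surjective_case_outer_conjugate
    (A B : Type*) [CStarAlgebra A] [CStarAlgebra B]
    (α : A →⋆ₐ[ℂ] A) (β : B →⋆ₐ[ℂ] B) (γ : A ≃⋆ₐ[ℂ] B)
    (hα : Function.Surjective α)
    (b₁ : B) (hright : ∃ c : B, b₁ * c = 1)
    (h : ∀ a : A, β (γ a) * b₁ = b₁ * γ (α a)) :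
    IsUnit b₁ ∧
      ∃ w ∈ unitary B, ∀ b : B, β b = w * (γ (α (γ.symm b))) * star w := by
  obtain ⟨c, hc⟩ := hright
  have hc' : star c * star b₁ = 1 := by rw [← star_mul, hc, star_one]
  have hstar : ∀ a : A, star b₁ * β (γ a) = γ (α a) * star b₁ := fun a ↦ by
    simpa [map_star] using congrArg star (h (star a))
  have hcentral : ∀ x : B, Commute (star b₁ * b₁) x := fun x ↦ by
    obtain ⟨a', rfl⟩ := γ.surjective x
    obtain ⟨a, rfl⟩ := hα a'
    calc star b₁ * b₁ * γ (α a) = star b₁ * (b₁ * γ (α a)) := mul_assoc _ _ _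
      _ = γ (α a) * (star b₁ * b₁) := by rw [← h, ← mul_assoc, hstar, mul_assoc]
  have hleft : star c * c * (star b₁ * b₁) = 1 :=
    calc star c * c * (star b₁ * b₁) = star c * (star b₁ * b₁ * c) := by
          rw [(hcentral c).eq, mul_assoc]
      _ = star c * star b₁ * (b₁ * c) := by simp only [mul_assoc]
      _ = 1 := by rw [hc, hc', one_mul]
  have hinner : star b₁ * b₁ * (star c * c) = 1 := by rw [(hcentral _).eq, hleft]
  have hinv : ∀ x : B, Commute (star c * c) x := fun x ↦
    Commute.units_inv_left (u := ⟨_, _, hinner, hleft⟩) (hcentral x)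
  have hb : star c * c * star b₁ * b₁ = 1 := by rw [mul_assoc, hleft]
  obtain ⟨d, hd, hdd, hdc⟩ := exists_isSelfAdjoint_central_mul_self_eq c hinv
  have hunit : b₁ * (star c * c * star b₁) = 1 := by
    rw [left_inv_eq_right_inv hb hc, hc]
  have hw : b₁ * d * star (b₁ * d) = 1 := by
    rw [star_mul, hd, mul_assoc, ← mul_assoc d, hdd, hunit]
  have hw' : star (b₁ * d) * (b₁ * d) = 1 := by
    rw [star_mul, hd, (hdc (star b₁)).eq, mul_assoc, (hdc (b₁ * d)).eq, mul_assoc b₁, hdd,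
      ← mul_assoc, hinner]
  refine ⟨⟨⟨b₁, _, hunit, hb⟩, rfl⟩, b₁ * d, ⟨hw', hw⟩, fun b ↦ ?_⟩
  have hbd : β b * (b₁ * d) = b₁ * d * γ (α (γ.symm b)) := by
    have := h (γ.symm b)
    rw [StarAlgEquiv.apply_symm_apply] at this
    rw [← mul_assoc, this, mul_assoc, mul_assoc, (hdc _).eq]
  rw [← hbd, mul_assoc, hw, mul_one]
end

section
/- Let (A, α) and (B, β) be C*-dynamical systems and γ : A → B a *-isomorphism. Suppose b₁ ∈ B is right invertible and satisfies β(γ(a)) b₁ = b₁ γ(α(a)) for all a ∈ A, and a₁ ∈ A is right invertible and satisfies α(γ⁻¹(b)) a₁ = a₁ γ⁻¹(β(b)) for all b ∈ B. Then γ(ker(αⁿ)) = ker(βⁿ) for every n ≥ 1, and γ(R_α) = R_β. -/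
/-- If `β (γ a) * b = b * γ (α a)` for a right invertible `b`, then `γ` maps `ker (α ^ n)` into
`ker (β ^ n)`. -/
theorem iterate_map_eq_zero_of_intertwining {A B : Type*} [Zero A] [Semiring B]
    {α : A → A} (β : B →+* B) {γ : A → B} (h₀ : γ 0 = 0) {b : B} (hbr : ∃ c : B, b * c = 1)
    (hb : ∀ a : A, β (γ a) * b = b * γ (α a)) (n : ℕ) {a : A} (h : α^[n] a = 0) :
    β^[n] (γ a) = 0 := by
  obtain ⟨c, hc⟩ := hbr
  induction n generalizing a with
  | zero => simpa [h₀] using congrArg γ h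
  | succ n ih =>
    rw [Function.iterate_succ_apply] at h ⊢
    have hβ : β (γ a) = b * γ (α a) * c := by rw [← hb, mul_assoc, hc, mul_one]
    rw [hβ, iterate_map_mul, iterate_map_mul, ih h, mul_zero, zero_mul]


/-- If `b₁` is right invertible with `β(γ(a)) b₁ = b₁ γ(α(a))` and `a₁` is right invertible
with `α(γ⁻¹(b)) a₁ = a₁ γ⁻¹(β(b))`, then `γ(ker(αⁿ)) = ker(βⁿ)` for all `n ≥ 1` and
`γ(R_α) = R_β`, where `R_α` is the closure of `⋃_{k ≥ 1} ker(α^k)`. -/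
theorem gamma_maps_kernels_and_radical
    (A B : Type*) [CStarAlgebra A] [CStarAlgebra B]
    (α : A →⋆ₐ[ℂ] A) (β : B →⋆ₐ[ℂ] B) (γ : A ≃⋆ₐ[ℂ] B)
    (b₁ : B) (a₁ : A)
    (hb₁r : ∃ c : B, b₁ * c = 1) (ha₁r : ∃ c : A, a₁ * c = 1)
    (hb : ∀ a : A, β (γ a) * b₁ = b₁ * γ (α a))
    (ha : ∀ b : B, α (γ.symm b) * a₁ = a₁ * γ.symm (β b)) :
    (∀ n : ℕ, 1 ≤ n →
      (⇑γ) '' {a : A | (⇑α)^[n] a = 0} = {b : B | (⇑β)^[n] b = 0}) ∧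
    (⇑γ) '' closure (⋃ n : ℕ, {a : A | (⇑α)^[n + 1] a = 0}) =
      closure (⋃ n : ℕ, {b : B | (⇑β)^[n + 1] b = 0}) := by
  have hker (n : ℕ) : γ '' {a : A | α^[n] a = 0} = {b : B | β^[n] b = 0} := by
    ext b
    constructor
    · rintro ⟨a, h, rfl⟩
      exact iterate_map_eq_zero_of_intertwining (β : B →+* B) (map_zero γ) hb₁r hb n h
    · intro h
      exact ⟨γ.symm b, iterate_map_eq_zero_of_intertwining (α : A →+* A) (map_zero γ.symm)
        ha₁r ha n h, γ.apply_symm_apply b⟩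
  refine ⟨fun n _ => hker n, ?_⟩
  have hγ : Isometry γ := StarAlgEquiv.isometry γ
  rw [← hγ.isClosedEmbedding.closure_image_eq, Set.image_iUnion]
  simp only [hker]
end

section
/- Let (A, α) be a C*-dynamical system. For an element a ∈ A, one has a ∈ R_α if and only if lim_{n→∞} ‖αⁿ(a)‖ = 0. -/
/-- The kernel of a star homomorphism of C⋆-algebras comes within `ε` of any element whose image has
norm at most `ε`. -/
theorem StarAlgHom.exists_map_eq_zero_norm_sub_le {A B : Type*} [CStarAlgebra A] [CStarAlgebra B]
    (φ : A →⋆ₐ[ℂ] B) {a : A} {ε : ℝ} (hε : 0 < ε) (ha : ‖φ a‖ ≤ ε) :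
    ∃ x, φ x = 0 ∧ ‖a - x‖ ≤ ε := by
  set b : A := star a * a with hb
  have hbs : IsSelfAdjoint b := .star_mul_self a
  set h : ℝ → ℝ := fun t => ε ^ 2 / max |t| (ε ^ 2) with hh
  have hpos (t : ℝ) : 0 < max |t| (ε ^ 2) := lt_max_of_lt_right (by positivity)
  have hcont : Continuous h := by
    refine continuous_const.div (by fun_prop) fun t => (hpos t).ne'
  have hφ : Continuous φ :=
    AddMonoidHomClass.continuous_of_bound φ 1 fun x => by
      simpa using NonUnitalStarAlgHom.norm_apply_le φ x
  have hφbs : IsSelfAdjoint (φ b) := hbs.map φ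
  have hφb : ‖φ b‖ ≤ ε ^ 2 := by
    rw [hb, map_mul, map_star, CStarRing.norm_star_mul_self, sq]
    gcongr
  have hmap : φ (cfc h b) = 1 := by
    rw [show φ (cfc h b) = cfc h (φ b) from StarAlgHomClass.map_cfc φ h b hcont.continuousOn hφ,
      ← cfc_const_one ℝ (φ b)]
    refine cfc_congr fun t ht => ?_
    have : Nontrivial B := by
      by_contra hB
      rw [not_nontrivial_iff_subsingleton] at hB
      simp [spectrum.of_subsingleton] at ht
    have ht' : |t| ≤ ε ^ 2 := (spectrum.norm_le_norm_of_mem ht).trans hφb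
    simp only [hh, max_eq_right ht']
    exact div_self (by positivity)
  refine ⟨a - a * cfc h b, by simp [hmap], ?_⟩
  rw [sub_sub_cancel]
  refine (sq_le_sq₀ (norm_nonneg _) hε.le).1 ?_
  have hsa : star (cfc h b) = cfc h b := IsSelfAdjoint.cfc (f := h) (a := b)
  have key : star (a * cfc h b) * (a * cfc h b) = cfc (fun t => h t * t * h t) b := by
    rw [cfc_mul (fun t => h t * t) h b (by fun_prop) (by fun_prop),
      cfc_mul h (fun t => t) b (by fun_prop) (by fun_prop), cfc_id' ℝ b, star_mul, hsa, hb]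
    simp only [mul_assoc]
  rw [sq, ← CStarRing.norm_star_mul_self, key]
  refine norm_cfc_le (by positivity) fun t _ => ?_
  have h1 : 0 ≤ h t := by simp only [hh]; positivity
  have h2 : h t ≤ 1 := div_le_one_of_le₀ (le_max_right _ _) (hpos t).le
  have h3 : h t * |t| ≤ ε ^ 2 := by
    calc h t * |t| ≤ h t * max |t| (ε ^ 2) := by gcongr; exact le_max_left _ _
      _ = ε ^ 2 := div_mul_cancel₀ _ (hpos t).ne'
  rw [norm_mul, norm_mul, Real.norm_of_nonneg h1, Real.norm_eq_abs]
  calc h t * |t| * h t ≤ ε ^ 2 * 1 := by gcongr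
    _ = ε ^ 2 := mul_one _

/-- An element `a` belongs to the radical ideal `R_α` (the closure of `⋃_{k ≥ 1} ker(α^k)`)
if and only if `‖αⁿ(a)‖ → 0`. -/
theorem mem_radical_iff_tendsto_zero
    (A : Type*) [CStarAlgebra A] (α : A →⋆ₐ[ℂ] A) (a : A) :
    a ∈ closure (⋃ k : ℕ, {x : A | (⇑α)^[k + 1] x = 0}) ↔
      Filter.Tendsto (fun n : ℕ => ‖(⇑α)^[n] a‖) Filter.atTop (nhds 0) := by
  have hpow (n : ℕ) : (⇑α)^[n] = ⇑(α ^ n) := by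
    induction n with
    | zero => rfl
    | succ n ih => rw [Function.iterate_succ, ih, pow_succ]; rfl
  rw [Metric.mem_closure_iff, Metric.tendsto_atTop]
  simp only [hpow, dist_zero_right, norm_norm]
  refine ⟨fun H ε hε => ?_, fun H ε hε => ?_⟩
  · obtain ⟨y, hy, hay⟩ := H ε hε
    obtain ⟨k, hk⟩ := Set.mem_iUnion.1 hy
    refine ⟨k + 1, fun n hn => ?_⟩
    have hny : (α ^ n) y = 0 := by
      rw [← Nat.sub_add_cancel hn, pow_add]
      change (α ^ (n - (k + 1))) ((α ^ (k + 1)) y) = 0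
      rw [show (α ^ (k + 1)) y = 0 from hk, map_zero]
    calc ‖(α ^ n) a‖ = ‖(α ^ n) (a - y)‖ := by rw [map_sub, hny, sub_zero]
      _ ≤ ‖a - y‖ := NonUnitalStarAlgHom.norm_apply_le _ _
      _ < ε := by rwa [← dist_eq_norm]
  · obtain ⟨N, hN⟩ := H (ε / 2) (half_pos hε)
    obtain ⟨x, hx, hax⟩ :=
      (α ^ (N + 1)).exists_map_eq_zero_norm_sub_le (half_pos hε) (hN (N + 1) N.le_succ).le
    refine ⟨x, Set.mem_iUnion.2 ⟨N, hx⟩, ?_⟩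
    rw [dist_eq_norm]
    exact hax.trans_lt (half_lt_self hε)
end

section
/- Let (A, α) and (B, β) be C*-dynamical systems and γ : A → B a *-isomorphism such that γ(ker(αⁿ)) = ker(βⁿ) for every n ≥ 1. Suppose b₀ ∈ B satisfies γ(a) b₀ = b₀ γ(α(a)) for all a ∈ A. Then x b₀ = 0 and b₀ x = 0 for every x ∈ R_β, i.e. b₀ ∈ ann(R_β). -/
/-- If `b * star b` commutes with `b` and `star b * c = 0`, then `b * c = 0`. -/
theorem mul_eq_zero_of_star_mul_eq_zero_of_commute {B : Type*} [CStarAlgebra B] {b c : B}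
    (hb : Commute (b * star b) b) (hc : star b * c = 0) : b * c = 0 := by
  have key : b * star b * (b * c) = 0 := by
    rw [← mul_assoc, hb.eq, mul_assoc, mul_assoc, hc, mul_zero, mul_zero]
  have hz : star b * (b * c) = 0 := by
    rw [← CStarRing.star_mul_self_eq_zero_iff, star_mul, star_star, mul_assoc, ← mul_assoc b,
      key, mul_zero]
  rw [← CStarRing.star_mul_self_eq_zero_iff, star_mul, mul_assoc, hz, mul_zero]

section Intertwiner

variable {A B : Type*} [CStarAlgebra A] [CStarAlgebra B]
  {α : A →⋆ₐ[ℂ] A} {γ : A ≃⋆ₐ[ℂ] B} {b₀ : B}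

theorem star_mul_of_intertwines (h : ∀ a : A, γ a * b₀ = b₀ * γ (α a)) (a : A) :
    star b₀ * γ a = γ (α a) * star b₀ := by
  simpa [map_star] using congrArg star (h (star a))

theorem commute_mul_star_of_intertwines (h : ∀ a : A, γ a * b₀ = b₀ * γ (α a)) (b : B) :
    Commute (b₀ * star b₀) b := by
  obtain ⟨a, rfl⟩ := EquivLike.surjective γ b
  rw [Commute, SemiconjBy, mul_assoc, star_mul_of_intertwines h, ← mul_assoc, ← h, mul_assoc]

theorem mul_eq_zero_of_intertwines_of_iterate_eq_zero
    (h : ∀ a : A, γ a * b₀ = b₀ * γ (α a)) (n : ℕ) (a : A) (ha : (⇑α)^[n] a = 0) :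
    γ a * b₀ = 0 ∧ b₀ * γ a = 0 := by
  induction n generalizing a with
  | zero =>
    obtain rfl : a = 0 := ha
    simp
  | succ n ih =>
    have hstar : (⇑α)^[n] (α (star a)) = 0 := by
      have hcomm : Function.Commute (⇑α) (star : A → A) := map_star α
      rw [← Function.iterate_succ_apply, (hcomm.iterate_left (n + 1)).eq, ha, star_zero]
    refine ⟨by rw [h, (ih _ ha).2], ?_⟩
    refine mul_eq_zero_of_star_mul_eq_zero_of_commute (commute_mul_star_of_intertwines h b₀) ?_
    rw [star_mul_of_intertwines h]
    simpa [map_star] using congrArg star (ih _ hstar).2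

end Intertwiner


/-- If `γ(ker(αⁿ)) = ker(βⁿ)` for all `n ≥ 1` and `γ(a) b₀ = b₀ γ(α(a))` for all `a ∈ A`,
then `b₀` annihilates the radical ideal `R_β` on both sides. -/
theorem b0_mem_annihilator_radical
    (A B : Type*) [CStarAlgebra A] [CStarAlgebra B]
    (α : A →⋆ₐ[ℂ] A) (β : B →⋆ₐ[ℂ] B) (γ : A ≃⋆ₐ[ℂ] B)
    (hker : ∀ n : ℕ, 1 ≤ n →
      (⇑γ) '' {a : A | (⇑α)^[n] a = 0} = {b : B | (⇑β)^[n] b = 0})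
    (b₀ : B) (h : ∀ a : A, γ a * b₀ = b₀ * γ (α a)) :
    ∀ x ∈ closure (⋃ k : ℕ, {y : B | (⇑β)^[k + 1] y = 0}),
      x * b₀ = 0 ∧ b₀ * x = 0 := by
  have hclosed : IsClosed {x : B | x * b₀ = 0 ∧ b₀ * x = 0} :=
    (isClosed_eq (by fun_prop) continuous_const).inter
      (isClosed_eq (by fun_prop) continuous_const)
  refine fun x hx => closure_minimal (Set.iUnion_subset fun k => ?_) hclosed hx
  rw [← hker (k + 1) (Nat.le_add_left 1 k)]
  rintro _ ⟨a, ha, rfl⟩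
  exact mul_eq_zero_of_intertwines_of_iterate_eq_zero h (k + 1) a ha
end

section
/- Let (A, α) be a C*-dynamical system. Then α(R_α) = R_α if and only if α(ker(α^{k+1})) = ker(α^k) for every k ≥ 0. -/
theorem continuous_starAlgHom {A : Type*} [CStarAlgebra A] (α : A →⋆ₐ[ℂ] A) : Continuous α :=
  AddMonoidHomClass.continuous_of_bound α 1 fun x => by
    simpa using NonUnitalStarAlgHom.norm_apply_le α x

theorem iterate_map_cfc {A : Type*} [CStarAlgebra A] (α : A →⋆ₐ[ℂ] A) (f : ℝ → ℝ)
    (hf : Continuous f) {x : A} (hx : IsSelfAdjoint x) (n : ℕ) :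
    IsSelfAdjoint ((⇑α)^[n] x) ∧ (⇑α)^[n] (cfc f x) = cfc f ((⇑α)^[n] x) := by
  induction n with
  | zero => exact ⟨hx, rfl⟩
  | succ n ih =>
    rw [Function.iterate_succ_apply', Function.iterate_succ_apply', ih.2]
    have h : IsSelfAdjoint (α ((⇑α)^[n] x)) := ih.1.map α
    refine ⟨h, ?_⟩
    exact StarAlgHomClass.map_cfc (α.restrictScalars ℝ) f _ hf.continuousOn
      (continuous_starAlgHom α) ih.1 h

/-- A self-adjoint element of `α(ker α^n)` lifts to `ker α^n` without increasing the norm. -/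
theorem exists_lift_selfAdjoint {A : Type*} [CStarAlgebra A] (α : A →⋆ₐ[ℂ] A) {n : ℕ} {x : A}
    (hx : IsSelfAdjoint x) (hn : (⇑α)^[n] x = 0) :
    ∃ z : A, (⇑α)^[n] z = 0 ∧ α z = α x ∧ ‖z‖ ≤ ‖α x‖ := by
  set r : ℝ := ‖α x‖ with hr
  have r0 : 0 ≤ r := norm_nonneg _
  let f : ℝ → ℝ := fun t => max (-r) (min r t)
  have hf : Continuous f := by fun_prop
  have f0 : f 0 = 0 := by simp [f, r0]
  refine ⟨cfc f x, ?_, ?_, ?_⟩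
  · rw [(iterate_map_cfc α f hf hx n).2, hn, cfc_apply_zero, f0, map_zero]
  · obtain ⟨h1, h2⟩ := iterate_map_cfc α f hf hx 1
    simp only [Function.iterate_one] at h1 h2
    rw [h2]
    conv_rhs => rw [← cfc_id ℝ (α x) h1]
    refine cfc_congr fun t ht => ?_
    have h : |t| ≤ r := by
      by_cases hA : Nontrivial A
      · exact spectrum.norm_le_norm_of_mem ht
      · rw [not_nontrivial_iff_subsingleton] at hA
        simp [spectrum.of_subsingleton] at ht
    obtain ⟨h3, h4⟩ := abs_le.1 h
    simp [f, h3, h4]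
  · refine norm_cfc_le r0 fun t _ => ?_
    rw [Real.norm_eq_abs, abs_le]
    exact ⟨le_max_left _ _, max_le (by linarith) (min_le_left _ _)⟩

theorem iterate_smul {A : Type*} [CStarAlgebra A] (α : A →⋆ₐ[ℂ] A) (c : ℂ) (x : A) (n : ℕ) :
    (⇑α)^[n] (c • x) = c • (⇑α)^[n] x := by
  induction n with
  | zero => rfl
  | succ n ih => rw [Function.iterate_succ_apply', Function.iterate_succ_apply', ih, map_smul]

theorem iterate_star {A : Type*} [CStarAlgebra A] (α : A →⋆ₐ[ℂ] A) (x : A) (n : ℕ) :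
    (⇑α)^[n] (star x) = star ((⇑α)^[n] x) := by
  induction n with
  | zero => rfl
  | succ n ih => rw [Function.iterate_succ_apply', Function.iterate_succ_apply', ih, map_star]

/-- Every element of `α(ker α^n)` lifts to `ker α^n` with norm increased by a factor at most `2`. -/
theorem exists_lift_norm_le {A : Type*} [CStarAlgebra A] (α : A →⋆ₐ[ℂ] A) {n : ℕ} {x : A}
    (hn : (⇑α)^[n] x = 0) :
    ∃ z : A, (⇑α)^[n] z = 0 ∧ α z = α x ∧ ‖z‖ ≤ 2 * ‖α x‖ := by
  have key : ∀ y : A, (⇑α)^[n] y = 0 → ∃ z : A, (⇑α)^[n] z = 0 ∧ α z = α (realPart y : A) ∧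
      ‖z‖ ≤ ‖α y‖ := by
    intro y hy
    have h0 : (⇑α)^[n] (realPart y : A) = 0 := by
      have h : (realPart y : A) = (2⁻¹ : ℂ) • (y + star y) := by
        rw [realPart_apply_coe, ← Complex.coe_smul]; simp
      rw [h, iterate_smul, iterate_map_add, iterate_star, hy]
      simp
    obtain ⟨z, h1, h2, h3⟩ := exists_lift_selfAdjoint α (realPart y).2 h0
    refine ⟨z, h1, h2, h3.trans ?_⟩
    have h : α (realPart y : A) = (realPart (α y) : A) := by
      simp [realPart_apply_coe, ← Complex.coe_smul, map_star α y]
    rw [h]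
    exact realPart.norm_le (α y)
  obtain ⟨a, a1, a2, a3⟩ := key x hn
  obtain ⟨b, b1, b2, b3⟩ := key ((-Complex.I) • x) (by rw [iterate_smul, hn, smul_zero])
  have him : realPart ((-Complex.I) • x) = imaginaryPart x := by
    simp
  rw [him] at b2
  refine ⟨a + Complex.I • b, ?_, ?_, ?_⟩
  · rw [iterate_map_add, iterate_smul, a1, b1]; simp
  · rw [map_add, map_smul, a2, b2, ← map_smul, ← map_add, realPart_add_I_smul_imaginaryPart]
  · refine (norm_add_le _ _).trans ?_
    rw [map_smul, norm_smul] at b3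
    rw [norm_smul]
    simp at b3 ⊢
    linarith

/-- The union of the kernels of the positive powers of `α`. -/
def kernelUnion {A : Type*} [CStarAlgebra A] (α : A →⋆ₐ[ℂ] A) : AddSubgroup A where
  carrier := ⋃ k : ℕ, {x : A | (⇑α)^[k + 1] x = 0}
  zero_mem' := Set.mem_iUnion.2 ⟨0, by simp⟩
  neg_mem' := by
    intro x hx
    obtain ⟨k, hk⟩ := Set.mem_iUnion.1 hx
    exact Set.mem_iUnion.2 ⟨k, by rw [Set.mem_ofPred_eq] at *; rw [iterate_map_neg, hk, neg_zero]⟩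
  add_mem' := by
    intro x y hx hy
    obtain ⟨k, hk⟩ := Set.mem_iUnion.1 hx
    obtain ⟨l, hl⟩ := Set.mem_iUnion.1 hy
    rw [Set.mem_ofPred_eq] at hk hl
    refine Set.mem_iUnion.2 ⟨k + l + 1, ?_⟩
    have h1 : (⇑α)^[k + l + 1 + 1] x = 0 := by
      rw [show k + l + 1 + 1 = (l + 1) + (k + 1) by omega, Function.iterate_add_apply, hk,
        iterate_map_zero]
    have h2 : (⇑α)^[k + l + 1 + 1] y = 0 := by
      rw [show k + l + 1 + 1 = (k + 1) + (l + 1) by omega, Function.iterate_add_apply, hl,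
        iterate_map_zero]
    rw [Set.mem_ofPred_eq, iterate_map_add, h1, h2, add_zero]

theorem mem_kernelUnion {A : Type*} [CStarAlgebra A] {α : A →⋆ₐ[ℂ] A} {x : A} :
    x ∈ kernelUnion α ↔ ∃ k : ℕ, (⇑α)^[k + 1] x = 0 :=
  Set.mem_iUnion

/-- `α(R_α) = R_α` if and only if `α(ker(α^{k+1})) = ker(α^k)` for every `k ≥ 0`,
where `R_α` is the closure of `⋃_{k ≥ 1} ker(α^k)` and `α⁰ = id`. -/
theorem image_radical_eq_iff_image_kernels
    (A : Type*) [CStarAlgebra A] (α : A →⋆ₐ[ℂ] A) :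
    (⇑α) '' closure (⋃ k : ℕ, {x : A | (⇑α)^[k + 1] x = 0}) =
        closure (⋃ k : ℕ, {x : A | (⇑α)^[k + 1] x = 0}) ↔
      ∀ k : ℕ, (⇑α) '' {x : A | (⇑α)^[k + 1] x = 0} = {x : A | (⇑α)^[k] x = 0} := by
  constructor
  · intro h k
    ext y
    simp only [Set.mem_image, Set.mem_ofPred_eq]
    constructor
    · rintro ⟨x, hx, rfl⟩
      rwa [← Function.iterate_succ_apply]
    · intro hy
      have hyR : y ∈ closure (⋃ k : ℕ, {x : A | (⇑α)^[k + 1] x = 0}) :=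
        subset_closure (Set.mem_iUnion.2 ⟨k, by
          rw [Set.mem_ofPred_eq, Function.iterate_succ_apply', hy, map_zero]⟩)
      rw [← h] at hyR
      obtain ⟨x, -, rfl⟩ := hyR
      exact ⟨x, by rwa [Function.iterate_succ_apply], rfl⟩
  · intro h
    change (⇑α) '' closure (kernelUnion α : Set A) = closure (kernelUnion α : Set A)
    apply Set.Subset.antisymm
    · refine (image_closure_subset_closure_image (continuous_starAlgHom α)).trans (closure_mono ?_)
      rintro _ ⟨x, hx, rfl⟩
      obtain ⟨k, hk⟩ := mem_kernelUnion.1 hx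
      refine mem_kernelUnion.2 ⟨k, ?_⟩
      rw [← Function.iterate_succ_apply, Function.iterate_succ_apply', hk, map_zero]
    · let R := (kernelUnion α).topologicalClosure
      have : CompleteSpace R :=
        (AddSubgroup.isClosed_topologicalClosure (kernelUnion α)).completeSpace_coe
      let f : NormedAddGroupHom R A :=
        AddMonoidHom.mkNormedAddGroupHom ((α : A →+ A).comp R.subtype) 1 fun x => by
          simpa using NonUnitalStarAlgHom.norm_apply_le α (x : A)
      have hf : f.SurjectiveOnWith (kernelUnion α) 2 := by
        intro y hy
        obtain ⟨k, hk⟩ := mem_kernelUnion.1 hy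
        have hy' : y ∈ (⇑α) '' {x : A | (⇑α)^[k + 1 + 1] x = 0} := by
          rw [h (k + 1)]; exact hk
        obtain ⟨x, hx, rfl⟩ := hy'
        obtain ⟨z, h1, h2, h3⟩ := exists_lift_norm_le α hx
        exact ⟨⟨z, subset_closure (mem_kernelUnion.2 ⟨k + 1, h1⟩)⟩, h2, h3⟩
      intro y hy
      obtain ⟨x, hx, -⟩ := controlled_closure_of_complete two_pos one_pos hf y hy
      exact ⟨x, x.2, hx⟩
end

section
/- Let B be a unital C*-algebra that is finite, in the sense that every isometry in B is a unitary (i.e. s*s = 1 implies ss* = 1). Then every right invertible element of B is invertible: if b, c ∈ B satisfy bc = 1, then b is invertible. -/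
/-- If `c` has a left inverse in a unital C*-algebra, then `star c * c` is invertible. -/
theorem isUnit_star_mul_self_of_mul_eq_one {B : Type*} [CStarAlgebra B] {b c : B}
    (h : b * c = 1) : IsUnit (star c * c) := by
  let _ : PartialOrder B := CStarAlgebra.spectralOrder B
  have _ : StarOrderedRing B := CStarAlgebra.spectralOrderedRing B
  have hle : (1 : B) ≤ ‖star b * b‖ • (star c * c) := by
    calc (1 : B) = star c * (star b * b) * c := by
          rw [← mul_assoc, mul_assoc, h, ← star_mul, h, star_one, one_mul]
      _ ≤ _ := CStarAlgebra.star_left_conjugate_le_norm_smul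
  have hu : IsUnit (‖star b * b‖ • (star c * c)) := CStarAlgebra.isUnit_of_le 1 hle
  rw [Algebra.smul_def, (Algebra.commute_algebraMap_left _ _).isUnit_mul_iff] at hu
  exact hu.2

/-- In a finite unital C*-algebra (every isometry is a unitary), every right invertible
element is invertible. -/
theorem right_invertible_of_finite_cstar
    (B : Type*) [CStarAlgebra B]
    (hfin : ∀ s : B, star s * s = 1 → s * star s = 1) :
    ∀ b c : B, b * c = 1 → IsUnit b := by
  intro b c h
  let _ : PartialOrder B := CStarAlgebra.spectralOrder B
  have _ : StarOrderedRing B := CStarAlgebra.spectralOrderedRing B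
  have hpos : IsStrictlyPositive (star c * c) :=
    (isUnit_star_mul_self_of_mul_eq_one h).isStrictlyPositive (star_mul_self_nonneg c)
  obtain ⟨u, hu⟩ := CFC.isUnit_sqrt_iff_isStrictlyPositive.mpr hpos
  have hsq : star c * c = (u : B) * u := by
    rw [hu, CFC.sqrt_mul_sqrt_self _ hpos.nonneg]
  have hsa : star u = u :=
    Units.ext (by rw [Units.coe_star, hu, (CFC.sqrt_nonneg _).isSelfAdjoint.star_eq])
  have hsi : star (↑u⁻¹ : B) = ↑u⁻¹ := by
    rw [← Units.coe_star, star_inv, hsa]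
  have hiso : star (c * ↑u⁻¹) * (c * ↑u⁻¹) = 1 := by
    rw [star_mul, hsi, mul_assoc, ← mul_assoc (star c), hsq]
    simp
  have hc : c * (↑u⁻¹ * star (c * ↑u⁻¹)) = 1 := by
    rw [← mul_assoc, hfin _ hiso]
  have hb : c * b = 1 := by
    rwa [← left_inv_eq_right_inv h hc] at hc
  exact ⟨⟨b, c, h, hb⟩, rfl⟩
end

section
/- Let B be a unital C*-algebra, let (Jₙ)_{n≥1} be an increasing sequence of closed two-sided ideals of B, and let J be the norm closure of ⋃_{n≥1} Jₙ. Suppose b ∈ B is invertible modulo J, i.e. there exists c ∈ B with bc − 1 ∈ J and cb − 1 ∈ J. Then there exist an integer n₀ ≥ 1 and c' ∈ B with bc' − 1 ∈ J_{n₀} and c'b − 1 ∈ J_{n₀}; that is, b is already invertible modulo J_{n₀} for some finite stage n₀. -/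
namespace TwoSidedIdeal

/-- An element with a left and a right inverse modulo a two-sided ideal has its right inverse
as a left inverse modulo the ideal. -/
theorem right_inverse_mul_sub_one_mem {R : Type*} [Ring R] (I : TwoSidedIdeal R) {b l r : R}
    (hl : l * b - 1 ∈ I) (hr : b * r - 1 ∈ I) : r * b - 1 ∈ I := by
  have h : r * b - 1 = l * (b * r - 1) * b - (l * b - 1) * (r * b) + (l * b - 1) := by
    noncomm_ring
  rw [h]
  exact I.add_mem (I.sub_mem (I.mul_mem_right _ _ (I.mul_mem_left _ _ hr))
    (I.mul_mem_right _ _ hl)) hl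

end TwoSidedIdeal

/-- If `a - 1` lies in the closure of `S`, then `a` differs from a unit by an element of `S`. -/
theorem exists_unit_eq_sub_of_sub_one_mem_closure {R : Type*} [NormedRing R] [CompleteSpace R]
    {S : Set R} {a : R} (ha : a - 1 ∈ closure S) : ∃ x ∈ S, ∃ u : Rˣ, (u : R) = a - x := by
  obtain ⟨x, hx, hdist⟩ := Metric.mem_closure_iff.1 ha 1 one_pos
  have h : ‖1 - (a - x)‖ < 1 := by
    have hneg : 1 - (a - x) = -(a - 1 - x) := by abel
    rwa [hneg, norm_neg, ← dist_eq_norm]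
  exact ⟨x, hx, Units.oneSub (1 - (a - x)) h, sub_sub_cancel _ _⟩

/-- If `(Jₙ)_{n ≥ 1}` is an increasing sequence of closed two-sided ideals of a unital
C*-algebra `B` with `J` the closure of their union, and `b` is invertible modulo `J`,
then `b` is already invertible modulo `J_{n₀}` for some finite stage `n₀ ≥ 1`. -/
theorem invertible_mod_union_of_ideals
    (B : Type*) [CStarAlgebra B]
    (J : ℕ → TwoSidedIdeal B)
    (hclosed : ∀ n : ℕ, 1 ≤ n → IsClosed (J n : Set B))
    (hmono : ∀ m n : ℕ, 1 ≤ m → m ≤ n → (J m : Set B) ⊆ (J n : Set B))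
    (b c : B)
    (hbc : b * c - 1 ∈ closure (⋃ n : ℕ, ⋃ _ : 1 ≤ n, (J n : Set B)))
    (hcb : c * b - 1 ∈ closure (⋃ n : ℕ, ⋃ _ : 1 ≤ n, (J n : Set B))) :
    ∃ n₀ : ℕ, 1 ≤ n₀ ∧ ∃ c' : B, b * c' - 1 ∈ J n₀ ∧ c' * b - 1 ∈ J n₀ := by
  obtain ⟨x, hx, u, hu⟩ := exists_unit_eq_sub_of_sub_one_mem_closure hbc
  obtain ⟨y, hy, v, hv⟩ := exists_unit_eq_sub_of_sub_one_mem_closure hcb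
  simp only [Set.mem_iUnion, exists_prop] at hx hy
  obtain ⟨m, hm, hx⟩ := hx
  obtain ⟨n, hn, hy⟩ := hy
  have hx : x ∈ J (max m n) := hmono m _ hm (le_max_left m n) hx
  have hy : y ∈ J (max m n) := hmono n _ hn (le_max_right m n) hy
  have hr : b * (c * ↑u⁻¹) - 1 ∈ J (max m n) := by
    have h : b * (c * ↑u⁻¹) - 1 = x * ↑u⁻¹ := by
      rw [← mul_assoc, ← u.mul_inv, ← sub_mul, hu, sub_sub_cancel]
    rw [h]
    exact (J _).mul_mem_right _ _ hx
  have hl : ↑v⁻¹ * c * b - 1 ∈ J (max m n) := by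
    have h : ↑v⁻¹ * c * b - 1 = ↑v⁻¹ * y := by
      rw [mul_assoc, ← v.inv_mul, ← mul_sub, hv, sub_sub_cancel]
    rw [h]
    exact (J _).mul_mem_left _ _ hy
  exact ⟨max m n, hm.trans (le_max_left m n), c * ↑u⁻¹, hr,
    (J _).right_inverse_mul_sub_one_mem hl hr⟩
end
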